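/- arXiv:2104.13234 — 4 statements merged into one kernel-verified Lean document; each statement's English description precedes it below -/
import Mathlib

section
/- Let g, h ∈ F_q[x] with g a monic divisor of x^n − 1, let f, k ∈ F_{q^n}[x] with k(L_g(c)) ∈ F_q \ {0} for every c ∈ F_{q^n}, and set P(x) = f(L_g(x)) + k(L_g(x))·L_h(x) ∈ F_{q^n}[x]. Then P is a permutation polynomial of F_{q^n} if and only if both (i) gcd(g, h) = 1 in F_q[x], and (ii) the map y ↦ L_g(f(y)) + k(y)·L_h(y) is a bijection of the set L_g(F_{q^n}) = {L_g(c) : c ∈ F_{q^n}} onto itself. -/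
open Polynomial

/-- The linearized `q`-associate of `f ∈ 𝔽_q[x]`, evaluated on an extension field:
`L_f(y) = Σ aᵢ y^(qⁱ)` where `q` is the cardinality of `Fq`. -/
noncomputable def Lq {Fq Fqn : Type*} [Field Fq] [Fintype Fq] [Field Fqn] [Algebra Fq Fqn]
    (f : Polynomial Fq) (y : Fqn) : Fqn :=
  f.sum fun i a => algebraMap Fq Fqn a * y ^ (Fintype.card Fq) ^ i

/-- `L_f` is the polynomial `f` applied to the `q`-Frobenius endomorphism. -/
theorem Lq_eq_aeval_frobenius {Fq Fqn : Type*} [Field Fq] [Fintype Fq] [Field Fqn]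
    [Algebra Fq Fqn] (f : Fq[X]) (y : Fqn) :
    Lq f y = aeval (FiniteField.frobeniusAlgHom Fq Fqn).toLinearMap f y := by
  have hpow (i : ℕ) : ((FiniteField.frobeniusAlgHom Fq Fqn).toLinearMap ^ i) y =
      y ^ Fintype.card Fq ^ i := by
    rw [Module.End.coe_pow]
    exact congrFun (pow_iterate (Fintype.card Fq) i) y
  rw [Lq, aeval_eq_sum_range, sum_over_range _ (by simp)]
  simp [LinearMap.sum_apply, hpow, Algebra.smul_def]

/-- If `g` and `h` are coprime, then the kernels of `g(φ)` and `h(φ)` meet trivially. -/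
theorem eq_zero_of_isCoprime_of_aeval_eq_zero {K V : Type*} [CommRing K] [AddCommGroup V]
    [Module K V] (φ : Module.End K V) {g h : K[X]} (hgh : IsCoprime g h) {v : V}
    (hg : aeval φ g v = 0) (hh : aeval φ h v = 0) : v = 0 :=
  Submodule.disjoint_def.mp (disjoint_ker_aeval_of_isCoprime φ hgh) v
    (LinearMap.mem_ker.mpr hg) (LinearMap.mem_ker.mpr hh)

/-- If `g` divides the minimal polynomial of `φ` and the kernels of `g(φ)` and `h(φ)` meet
trivially, then `g` and `h` are coprime. -/
theorem isCoprime_of_ker_aeval_inf {K V : Type*} [Field K] [AddCommGroup V]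
    [Module K V] [FiniteDimensional K V] (φ : Module.End K V) {g h : K[X]}
    (hg : g ∣ minpoly K φ)
    (hker : ∀ v, aeval φ g v = 0 → aeval φ h v = 0 → v = 0) : IsCoprime g h := by
  have hmin : minpoly K φ ≠ 0 := minpoly.ne_zero (Algebra.IsIntegral.isIntegral φ)
  refine isCoprime_of_dvd g h (fun hz => hmin (zero_dvd_iff.mp (hz.1 ▸ hg))) ?_
  rintro d hd - ⟨a, rfl⟩ ⟨b, rfl⟩
  obtain ⟨e, he⟩ := (dvd_mul_right d a).trans hg
  have hde : d * e ≠ 0 := he ▸ hmin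
  have hzero : aeval φ e = 0 := by
    ext v
    have hdv : aeval φ d (aeval φ e v) = 0 := by
      rw [← Module.End.mul_apply, ← map_mul, ← he, minpoly.aeval, LinearMap.zero_apply]
    apply hker
    · rw [mul_comm, map_mul, Module.End.mul_apply, hdv, map_zero]
    · rw [mul_comm, map_mul, Module.End.mul_apply, hdv, map_zero]
  obtain ⟨c, hc⟩ := minpoly.dvd K φ hzero
  refine hd (IsUnit.of_mul_eq_one c (mul_right_cancel₀ (right_ne_zero_of_mul hde) ?_))
  linear_combination -hc - c * he

/-- **Permutation criterion.** Let `g` be a monic divisor of `xⁿ - 1` in `𝔽_q[x]`,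
`h ∈ 𝔽_q[x]`, `f, k ∈ 𝔽_{qⁿ}[x]` with `k(L_g(c)) ∈ 𝔽_q \ {0}` for all `c ∈ 𝔽_{qⁿ}`.
Then `P(x) = f(L_g(x)) + k(L_g(x))·L_h(x)` is a PP of `𝔽_{qⁿ}` iff `gcd(g, h) = 1`
and `y ↦ L_g(f(y)) + k(y)·L_h(y)` is a bijection of `L_g(𝔽_{qⁿ})` onto itself. -/
theorem PP_iff_gcd_and_bijOn {Fq Fqn : Type*} [Field Fq] [Fintype Fq] [DecidableEq Fq]
    [Field Fqn] [Algebra Fq Fqn]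
    {n : ℕ} (hn : 0 < n) (hrank : Module.finrank Fq Fqn = n)
    (g h : Polynomial Fq) (hg : g.Monic) (hgdvd : g ∣ X ^ n - 1)
    (f k : Polynomial Fqn)
    (hk : ∀ c : Fqn, ∃ b : Fq, b ≠ 0 ∧ k.eval (Lq g c) = algebraMap Fq Fqn b) :
    Function.Bijective
        (fun c : Fqn => f.eval (Lq g c) + k.eval (Lq g c) * Lq h c) ↔
      (gcd g h = 1 ∧
        Set.BijOn (fun y : Fqn => Lq g (f.eval y) + k.eval y * Lq h y)
          (Set.range fun c : Fqn => Lq g c) (Set.range fun c : Fqn => Lq g c)) := by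
  have : FiniteDimensional Fq Fqn := FiniteDimensional.of_finrank_pos (hrank ▸ hn)
  have : Finite Fqn := Module.finite_of_finite Fq
  set φ := (FiniteField.frobeniusAlgHom Fq Fqn).toLinearMap with hφ
  have hL (p : Fq[X]) : Lq (Fqn := Fqn) p = aeval φ p :=
    funext fun y => Lq_eq_aeval_frobenius p y
  simp only [hL] at hk ⊢
  have hmin : g ∣ minpoly Fq φ := by
    rwa [hφ, FiniteField.minpoly_frobeniusAlgHom, hrank]
  have hgcd : gcd g h = 1 ↔ IsCoprime g h := by
    rw [← gcd_isUnit_iff, ← normalize_eq_one, normalize_gcd]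
  have hcomm (c : Fqn) :
      aeval φ g (f.eval (aeval φ g c) + k.eval (aeval φ g c) * aeval φ h c) =
        aeval φ g (f.eval (aeval φ g c)) + k.eval (aeval φ g c) * aeval φ h (aeval φ g c) := by
    obtain ⟨b, -, hb⟩ := hk c
    rw [hb, ← Algebra.smul_def, ← Algebra.smul_def, map_add, map_smul,
      ← Module.End.mul_apply, ← Module.End.mul_apply, ← map_mul, ← map_mul, mul_comm g h]
  rw [hgcd]
  constructor
  · intro hP
    constructor
    · refine isCoprime_of_ker_aeval_inf φ hmin fun v hgv hhv => hP.injective ?_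
      simp [hgv, hhv]
    · have hmaps : Set.MapsTo (fun y => aeval φ g (f.eval y) + k.eval y * aeval φ h y)
          (Set.range fun c => aeval φ g c) (Set.range fun c => aeval φ g c) := by
        rintro _ ⟨c, rfl⟩
        exact ⟨_, hcomm c⟩
      have hsurj : Set.SurjOn (fun y => aeval φ g (f.eval y) + k.eval y * aeval φ h y)
          (Set.range fun c => aeval φ g c) (Set.range fun c => aeval φ g c) := by
        rintro _ ⟨d, rfl⟩
        obtain ⟨c, rfl⟩ := hP.surjective d
        exact ⟨_, ⟨c, rfl⟩, (hcomm c).symm⟩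
      exact ((Set.toFinite _).surjOn_iff_bijOn_of_mapsTo hmaps).mp hsurj
  · rintro ⟨hcop, hbij⟩
    refine Function.Injective.bijective_of_finite fun c d hcd => ?_
    have hgc : aeval φ g c = aeval φ g d := by
      refine hbij.injOn ⟨c, rfl⟩ ⟨d, rfl⟩ ?_
      simpa only [hcomm] using congrArg (aeval φ g) hcd
    obtain ⟨b, hb0, hb⟩ := hk d
    have hkd : k.eval (aeval φ g d) ≠ 0 := by
      rw [hb]
      exact (_root_.map_ne_zero _).mpr hb0
    have hh : aeval φ h c = aeval φ h d := by
      simpa [hgc, hkd] using hcd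
    refine sub_eq_zero.mp (eq_zero_of_isCoprime_of_aeval_eq_zero φ hcop ?_ ?_)
    · rw [map_sub, hgc, sub_self]
    · rw [map_sub, hh, sub_self]
end

section
/- Let h ∈ F_q[x] and f ∈ F_{q^n}[x], and set P(x) = f(Tr_{q^n/q}(x)) + L_h(x) ∈ F_{q^n}[x]. Then P is a complete permutation polynomial of F_{q^n} if and only if both (i) gcd(h(x)·(h(x) + 1), (x^n − 1)/(x − 1)) = 1 in F_q[x], and (ii) Q(x) := T_n[f](x) + h(1)·x ∈ F_q[x] is a complete permutation polynomial of F_q. -/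
open Polynomial

/-- `T_n[f](x) = Σ Tr(aᵢ) xⁱ ∈ 𝔽_q[x]` for `f = Σ aᵢ xⁱ ∈ 𝔽_{qⁿ}[x]`, where `Tr` is the
field trace from `𝔽_{qⁿ}` onto `𝔽_q`. -/
noncomputable def Tn (Fq : Type*) {Fqn : Type*} [Field Fq] [Field Fqn] [Algebra Fq Fqn]
    (f : Polynomial Fqn) : Polynomial Fq :=
  f.sum fun i a => C (Algebra.trace Fq Fqn a) * X ^ i

/-- Coprimality with a divisor of the minimal polynomial of `T` is detected by kernels. -/
theorem isCoprime_iff_forall_aeval_apply_eq_zero {K V : Type*} [Field K] [AddCommGroup V]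
    [Module K V] {T : Module.End K V} (hT : IsIntegral K T) {g : K[X]} (hg : g ∣ minpoly K T)
    (h : K[X]) :
    IsCoprime h g ↔ ∀ x : V, aeval T h x = 0 → aeval T g x = 0 → x = 0 := by
  constructor
  · rintro ⟨a, b, hab⟩ x hx hx'
    have hx1 := congrArg (fun r => aeval T r x) hab
    simpa [hx, hx'] using hx1.symm
  · intro H
    refine IsRelPrime.isCoprime fun d hdh hdg => ?_
    obtain ⟨e, he⟩ := hdg.trans hg
    have he0 : aeval T e = 0 := by
      have hker : ∀ r : K[X], d ∣ r → ∀ x, aeval T r (aeval T e x) = 0 := by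
        rintro _ ⟨s, rfl⟩ x
        rw [← Module.End.mul_apply, ← map_mul, mul_right_comm, ← he, map_mul, minpoly.aeval]
        simp
      exact LinearMap.ext fun x => H _ (hker h hdh x) (hker g hdg x)
    have he' : e ≠ 0 := fun h0 => minpoly.ne_zero hT (by rw [he, h0, mul_zero])
    obtain ⟨c, hc⟩ := minpoly.dvd K T he0
    refine .of_mul_eq_one c (mul_right_cancel₀ he' ?_)
    rw [one_mul, mul_right_comm, ← he, ← hc]

theorem geom_sum_X_eq_div {K : Type*} [Field K] (n : ℕ) :
    ((X ^ n - 1) / (X - 1) : K[X]) = ∑ i ∈ Finset.range n, X ^ i := by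
  rw [← mul_geom_sum, mul_div_cancel_left₀]
  exact X_sub_C_ne_zero (1 : K)

theorem trace_eval_algebraMap {K L : Type*} [Field K] [Field L] [Algebra K L] (f : L[X])
    (c : K) :
    Algebra.trace K L (f.eval (algebraMap K L c)) = (Tn K f).eval c := by
  rw [Tn, sum_def, eval_finsetSum, eval_eq_sum, sum_def, map_sum]
  refine Finset.sum_congr rfl fun i _ => ?_
  rw [← map_pow, mul_comm, ← Algebra.smul_def, map_smul, smul_eq_mul, mul_comm, eval_C_mul,
    eval_X_pow]

section Frobenius

variable {K L : Type*} [Field K] [Fintype K] [Field L] [Algebra K L]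

theorem Lq_eq_aeval_frobenius_s14 (h : K[X]) (y : L) :
    Lq h y = aeval (FiniteField.frobeniusAlgHom K L).toLinearMap h y := by
  rw [Lq, aeval_eq_sum_range, sum_over_range _ (by simp)]
  simp [Module.End.coe_pow, FiniteField.coe_frobeniusAlgHom, pow_iterate, Algebra.smul_def]

theorem Lq_sub (h : K[X]) (x y : L) : Lq h (x - y) = Lq h x - Lq h y := by
  simp [Lq_eq_aeval_frobenius_s14]

theorem Lq_add_one (h : K[X]) (x : L) : Lq (h + 1) x = Lq h x + x := by
  simp [Lq_eq_aeval_frobenius_s14]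

theorem Lq_geom_sum [Finite L] (x : L) :
    Lq (∑ i ∈ Finset.range (Module.finrank K L), X ^ i : K[X]) x =
      algebraMap K L (Algebra.trace K L x) := by
  simp [Lq_eq_aeval_frobenius_s14, FiniteField.algebraMap_trace_eq_sum_pow, Module.End.coe_pow,
    FiniteField.coe_frobeniusAlgHom, pow_iterate]

theorem trace_Lq [Algebra.IsAlgebraic K L] (h : K[X]) (x : L) :
    Algebra.trace K L (Lq h x) = h.eval 1 * Algebra.trace K L x := by
  have hpow (i : ℕ) : Algebra.trace K L (x ^ Fintype.card K ^ i) = Algebra.trace K L x := by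
    rw [← Algebra.trace_eq_of_algEquiv (FiniteField.frobeniusAlgEquivOfAlgebraic K L ^ i) x,
      AlgEquiv.coe_pow, FiniteField.coe_frobeniusAlgEquivOfAlgebraic_iterate]
  simp [Lq, sum_def, ← Algebra.smul_def, hpow, eval_eq_sum, Finset.sum_mul]

theorem isCoprime_geom_sum_iff [Finite L] (h : K[X]) :
    IsCoprime h (∑ i ∈ Finset.range (Module.finrank K L), X ^ i : K[X]) ↔
      ∀ x : L, Lq h x = 0 → Algebra.trace K L x = 0 → x = 0 := by
  have : FiniteDimensional K L := Module.Finite.of_finite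
  rw [isCoprime_iff_forall_aeval_apply_eq_zero
    (T := (FiniteField.frobeniusAlgHom K L).toLinearMap) (Algebra.IsIntegral.isIntegral _)
    (by rw [FiniteField.minpoly_frobeniusAlgHom]; exact ⟨_, (geom_sum_mul X _).symm⟩)]
  simp only [← Lq_eq_aeval_frobenius_s14, Lq_geom_sum, map_eq_zero]

/-- The map `x ↦ f(Tr(x)) + L_h(x)` permutes `L` iff `h` is coprime to `1 + x + ⋯ + x^(n-1)` and
the induced map on traces permutes `K`. -/
theorem bijective_eval_trace_add_Lq_iff [Finite L] (h : K[X]) (f : L[X]) :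
    Function.Bijective (fun x : L => f.eval (algebraMap K L (Algebra.trace K L x)) + Lq h x) ↔
      IsCoprime h (∑ i ∈ Finset.range (Module.finrank K L), X ^ i : K[X]) ∧
        Function.Bijective fun c : K => (Tn K f + C (h.eval 1) * X : K[X]).eval c := by
  have : FiniteDimensional K L := Module.Finite.of_finite
  have htr (x : L) :
      Algebra.trace K L (f.eval (algebraMap K L (Algebra.trace K L x)) + Lq h x) =
        (Tn K f + C (h.eval 1) * X : K[X]).eval (Algebra.trace K L x) := by
    simp [trace_eval_algebraMap, trace_Lq]
  rw [isCoprime_geom_sum_iff]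
  constructor
  · refine fun hP => ⟨fun x hx hx' => hP.injective ?_,
      Finite.surjective_iff_bijective.mp fun c => ?_⟩
    · have h0 : Lq h (0 : L) = 0 := by simp [Lq_eq_aeval_frobenius_s14]
      simp [hx, hx', h0]
    · obtain ⟨y, rfl⟩ := Algebra.trace_surjective K L c
      obtain ⟨x, rfl⟩ := hP.surjective y
      exact ⟨Algebra.trace K L x, (htr x).symm⟩
  · rintro ⟨hker, hQ⟩
    refine Finite.injective_iff_bijective.mp fun x y hxy => ?_
    have hT : Algebra.trace K L x = Algebra.trace K L y :=
      hQ.injective (by simpa only [htr] using congrArg (Algebra.trace K L) hxy)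
    refine sub_eq_zero.mp (hker _ ?_ (by rw [map_sub, hT, sub_self]))
    rw [Lq_sub, sub_eq_zero]
    simpa [hT] using hxy

end Frobenius

/-- Let `h ∈ 𝔽_q[x]` and `f ∈ 𝔽_{qⁿ}[x]`. Then `P(x) = f(Tr(x)) + L_h(x)` is a complete
permutation polynomial of `𝔽_{qⁿ}` iff `gcd(h·(h+1), (xⁿ-1)/(x-1)) = 1` in `𝔽_q[x]` and
`Q(x) = T_n[f](x) + h(1)·x` is a complete permutation polynomial of `𝔽_q`. -/
theorem trace_CPP_iff {Fq Fqn : Type*} [Field Fq] [Fintype Fq] [DecidableEq Fq]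
    [Field Fqn] [Algebra Fq Fqn]
    {n : ℕ} (hn : 0 < n) (hrank : Module.finrank Fq Fqn = n)
    (h : Polynomial Fq) (f : Polynomial Fqn) :
    (Function.Bijective (fun x : Fqn =>
        f.eval (algebraMap Fq Fqn (Algebra.trace Fq Fqn x)) + Lq h x) ∧
      Function.Bijective (fun x : Fqn =>
        (f.eval (algebraMap Fq Fqn (Algebra.trace Fq Fqn x)) + Lq h x) + x)) ↔
      (gcd (h * (h + 1)) ((X ^ n - 1) / (X - 1) : Polynomial Fq) = 1 ∧
        (Function.Bijective (fun c : Fq =>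
            (Tn Fq f + C (h.eval 1) * X : Polynomial Fq).eval c) ∧
          Function.Bijective fun c : Fq =>
            (Tn Fq f + C (h.eval 1) * X : Polynomial Fq).eval c + c)) := by
  subst hrank
  have : FiniteDimensional Fq Fqn := Module.finite_of_finrank_pos hn
  have : Finite Fqn := Module.finite_of_finite Fq
  have hP := bijective_eval_trace_add_Lq_iff (h + 1) f
  have hQ (c : Fq) : (Tn Fq f + C ((h + 1).eval 1) * X : Fq[X]).eval c =
      (Tn Fq f + C (h.eval 1) * X : Fq[X]).eval c + c := by
    simp [add_mul, add_assoc]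
  simp only [Lq_add_one, hQ, ← add_assoc] at hP
  rw [bijective_eval_trace_add_Lq_iff, hP, geom_sum_X_eq_div, ← normalize_gcd, normalize_eq_one,
    gcd_isUnit_iff, IsCoprime.mul_left_iff]
  tauto
end

section
/- Let b ∈ F_q[x] be a permutation polynomial of F_q, let n be a positive integer, and let h, k ∈ F_q[x] with gcd(h(x), (x^n − 1)/(x − 1)) = 1 in F_q[x] and k(c) ∈ F_q \ {0} for every c ∈ F_q. Then for every polynomial f ∈ F_{q^n}[x] such that T_n[f](x) ≡ b(x) − h(1)·k(x)·x (mod x^q − x), the polynomial P(x) = f(Tr_{q^n/q}(x)) + k(Tr_{q^n/q}(x))·L_h(x) is a permutation polynomial of F_{q^n}. -/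
open Polynomial

namespace Lq

variable {Fq Fqn : Type*} [Field Fq] [Fintype Fq] [Field Fqn] [Algebra Fq Fqn]

/-- `L_f` is the polynomial `f` evaluated at the Frobenius endomorphism. -/
theorem eq_aeval_frobenius (f : Polynomial Fq) (y : Fqn) :
    Lq f y = aeval (FiniteField.frobeniusAlgHom Fq Fqn).toLinearMap f y := by
  have hpow (i : ℕ) : ((FiniteField.frobeniusAlgHom Fq Fqn).toLinearMap ^ i) y =
      y ^ Fintype.card Fq ^ i := by
    induction i with
    | zero => simp
    | succ i ih => simp [pow_succ', ih, ← pow_mul, mul_comm]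
  simp [Lq, aeval_eq_sum_range, sum_over_range, hpow, Algebra.smul_def]

theorem trace_eq [FiniteDimensional Fq Fqn] (f : Polynomial Fq) (y : Fqn) :
    Algebra.trace Fq Fqn (Lq f y) = f.eval 1 * Algebra.trace Fq Fqn y := by
  have hfrob (i : ℕ) : Algebra.trace Fq Fqn (y ^ Fintype.card Fq ^ i) =
      Algebra.trace Fq Fqn y := by
    induction i with
    | zero => simp
    | succ i ih =>
      have : Finite Fqn := Module.finite_of_finite Fq
      rw [← ih, pow_succ, pow_mul]
      exact Algebra.trace_eq_of_algEquiv (FiniteField.frobeniusAlgEquivOfAlgebraic Fq Fqn) _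
  simp [Lq, eval_eq_sum, Polynomial.sum, map_sum, ← Algebra.smul_def, hfrob, Finset.sum_mul]

theorem algebraMap_trace_eq [FiniteDimensional Fq Fqn] (y : Fqn) :
    algebraMap Fq Fqn (Algebra.trace Fq Fqn y) =
      Lq (∑ i ∈ Finset.range (Module.finrank Fq Fqn), X ^ i : Polynomial Fq) y := by
  have : Finite Fqn := Module.finite_of_finite Fq
  rw [FiniteField.algebraMap_trace_eq_sum_pow, eq_aeval_frobenius, map_sum,
    LinearMap.sum_apply]
  refine Finset.sum_congr rfl fun i _ => ?_
  rw [← eq_aeval_frobenius]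
  simp [Lq, ← monomial_one_right_eq_X_pow, sum_monomial_index]

theorem eq_zero_of_isCoprime {f g : Polynomial Fq} (hfg : IsCoprime f g) {y : Fqn}
    (hf : Lq f y = 0) (hg : Lq g y = 0) : y = 0 := by
  obtain ⟨u, v, huv⟩ := hfg
  rw [eq_aeval_frobenius] at hf hg
  have := congrArg (fun p => aeval (FiniteField.frobeniusAlgHom Fq Fqn).toLinearMap p y) huv
  simpa [hf, hg] using this.symm

end Lq

theorem Tn_eval {Fq Fqn : Type*} [Field Fq] [Field Fqn] [Algebra Fq Fqn]
    (f : Polynomial Fqn) (c : Fq) :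
    (Tn Fq f).eval c = Algebra.trace Fq Fqn (f.eval (algebraMap Fq Fqn c)) := by
  rw [Tn, eval_eq_sum (p := f), Polynomial.sum, Polynomial.sum, eval_finsetSum, map_sum]
  refine Finset.sum_congr rfl fun i _ => ?_
  rw [← map_pow, mul_comm (f.coeff i), ← Algebra.smul_def]
  rw [map_smul, smul_eq_mul, eval_mul, eval_C, eval_pow, eval_X, mul_comm]

theorem X_pow_sub_one_div_X_sub_one {K : Type*} [Field K] (n : ℕ) :
    ((X ^ n - 1) / (X - 1) : Polynomial K) = ∑ i ∈ Finset.range n, X ^ i := by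
  rw [← geom_sum_mul]
  exact mul_div_cancel_right₀ _ (X_sub_C_ne_zero 1)

/-- **From PPs of `𝔽_q` to PPs of `𝔽_{qⁿ}`.** Let `b ∈ 𝔽_q[x]` be a PP of `𝔽_q`, and
`h, k ∈ 𝔽_q[x]` with `gcd(h, (xⁿ-1)/(x-1)) = 1` and `k(c) ≠ 0` for all `c ∈ 𝔽_q`. Then
for every `f ∈ 𝔽_{qⁿ}[x]` with `T_n[f](x) ≡ b(x) - h(1)·k(x)·x (mod x^q - x)`, the
polynomial `P(x) = f(Tr(x)) + k(Tr(x))·L_h(x)` permutes `𝔽_{qⁿ}`. -/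
theorem PP_construction_from_base {Fq Fqn : Type*} [Field Fq] [Fintype Fq] [DecidableEq Fq]
    [Field Fqn] [Algebra Fq Fqn]
    {n : ℕ} (hn : 0 < n) (hrank : Module.finrank Fq Fqn = n)
    (b : Polynomial Fq) (hb : Function.Bijective fun c : Fq => b.eval c)
    (h k : Polynomial Fq)
    (hgcd : gcd h ((X ^ n - 1) / (X - 1) : Polynomial Fq) = 1)
    (hk : ∀ c : Fq, k.eval c ≠ 0)
    (f : Polynomial Fqn)
    (hf : (X ^ Fintype.card Fq - X : Polynomial Fq) ∣
      Tn Fq f - (b - C (h.eval 1) * k * X)) :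
    Function.Bijective fun x : Fqn =>
      f.eval (algebraMap Fq Fqn (Algebra.trace Fq Fqn x)) +
        algebraMap Fq Fqn (k.eval (Algebra.trace Fq Fqn x)) * Lq h x := by
  subst hrank
  have : FiniteDimensional Fq Fqn := Module.finite_of_finrank_pos hn
  have : Finite Fqn := Module.finite_of_finite Fq
  rw [X_pow_sub_one_div_X_sub_one] at hgcd
  have hcop : IsCoprime h (∑ i ∈ Finset.range (Module.finrank Fq Fqn), X ^ i) :=
    (gcd_isUnit_iff _ _).1 (hgcd ▸ isUnit_one)
  have hTn (c : Fq) : (Tn Fq f).eval c = b.eval c - h.eval 1 * k.eval c * c := by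
    simpa [FiniteField.pow_card, sub_eq_zero] using eval_dvd (x := c) hf
  have htrace (x : Fqn) : Algebra.trace Fq Fqn
      (f.eval (algebraMap Fq Fqn (Algebra.trace Fq Fqn x)) +
        algebraMap Fq Fqn (k.eval (Algebra.trace Fq Fqn x)) * Lq h x) =
      b.eval (Algebra.trace Fq Fqn x) := by
    rw [map_add, ← Tn_eval, hTn, ← Algebra.smul_def, map_smul, Lq.trace_eq, smul_eq_mul]
    ring
  refine Finite.injective_iff_bijective.1 fun x y hxy => ?_
  have htr : Algebra.trace Fq Fqn x = Algebra.trace Fq Fqn y := hb.1 <| by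
    simpa only [htrace] using congrArg (Algebra.trace Fq Fqn) hxy
  have hL : Lq h x = Lq h y := by
    simpa [htr, hk] using hxy
  refine sub_eq_zero.1 (Lq.eq_zero_of_isCoprime hcop ?_ ?_)
  · simpa [Lq.eq_aeval_frobenius, sub_eq_zero] using hL
  · rw [← Lq.algebraMap_trace_eq, map_sub, htr, sub_self, map_zero]
end

section
/- Let a ∈ F_q with a^n = 1 and let δ ∈ F_{q^n} be a nonzero element with δ^q = a·δ. Set L_{g_a}(x) = x^{q^{n−1}} + a·x^{q^{n−2}} + ... + a^{n−1}·x, the linearized q-associate of g_a(x) = (x^n − 1)/(x − a). Let h ∈ F_q[x], let f(x) = Σ_{i=0}^{m} a_i x^i ∈ F_{q^n}[x], and let k ∈ F_{q^n}[x] with k(δ·c) ∈ F_q \ {0} for every c ∈ F_q. Then P(x) = f(L_{g_a}(x)) + k(L_{g_a}(x))·L_h(x) is a permutation polynomial of F_{q^n} if and only if both (1) gcd(h(x), (x^n − 1)/(x − a)) = 1 in F_q[x], and (2) Q̄_a(x) = a^{−1}·Σ_{i=0}^{m} Tr_{q^n/q}(δ^{i−1}·a_i)·x^i + k(δ·x)·h(a)·x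 is a permutation polynomial of F_q. -/
open Polynomial

/-- A self-map of a finite set that lifts a self-map of a quotient is bijective iff the quotient map
is bijective and the lift is injective on fibres. -/
theorem bijective_iff_of_semiconj {A B : Type*} [Finite A] {t : A → B}
    (ht : Function.Surjective t) {R : A → A} {Q : B → B} (hRQ : ∀ x, t (R x) = Q (t x)) :
    Function.Bijective R ↔
      (∀ x y, t x = t y → R x = R y → x = y) ∧ Function.Bijective Q := by
  have : Finite B := Finite.of_surjective t ht
  constructor
  · intro hR
    refine ⟨fun x y _ hxy => hR.1 hxy, Finite.surjective_iff_bijective.1 fun b => ?_⟩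
    obtain ⟨x, rfl⟩ := ht b
    obtain ⟨y, rfl⟩ := hR.2 x
    exact ⟨t y, (hRQ y).symm⟩
  · rintro ⟨hfib, hQ⟩
    refine Finite.injective_iff_bijective.1 fun x y hxy => hfib x y (hQ.1 ?_) hxy
    rw [← hRQ, ← hRQ, hxy]

/-- For a divisor `g` of the minimal polynomial of `T`, the kernels of `h(T)` and `g(T)` meet trivially
iff `h` and `g` are coprime. -/
theorem isCoprime_iff_ker_aeval_disjoint {K V : Type*} [Field K] [AddCommGroup V] [Module K V]
    [FiniteDimensional K V] (T : Module.End K V) {g : K[X]} (hg : g ∣ minpoly K T) (h : K[X]) :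
    IsCoprime h g ↔ ∀ x, aeval T h x = 0 → aeval T g x = 0 → x = 0 := by
  constructor
  · rintro ⟨u, v, huv⟩ x hx hgx
    have := congr(aeval T $huv x)
    simpa [hx, hgx] using this.symm
  · intro H
    classical
    rw [← EuclideanDomain.gcd_isUnit_iff]
    obtain ⟨e, he⟩ := (EuclideanDomain.gcd_dvd_right h g).trans hg
    obtain ⟨u, hu⟩ := EuclideanDomain.gcd_dvd_left h g
    obtain ⟨v, hv⟩ := EuclideanDomain.gcd_dvd_right h g
    generalize EuclideanDomain.gcd h g = d at *
    have hde : ∀ x, aeval T d (aeval T e x) = 0 := fun x => by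
      rw [← Module.End.mul_apply, ← map_mul, ← he, minpoly.aeval, LinearMap.zero_apply]
    have he0 : aeval T e = 0 := LinearMap.ext fun x => by
      refine H _ ?_ ?_
      · rw [hu, mul_comm, map_mul, Module.End.mul_apply, hde, map_zero]
      · rw [hv, mul_comm, map_mul, Module.End.mul_apply, hde, map_zero]
    have hm0 : minpoly K T ≠ 0 := minpoly.ne_zero (Algebra.IsIntegral.isIntegral T)
    obtain ⟨w, hw⟩ := minpoly.dvd K T he0
    refine IsUnit.of_mul_eq_one w (mul_left_cancel₀ hm0 ?_)
    linear_combination -he - d * hw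

section Frobenius

open FiniteField

variable {Fq Fqn : Type*} [Field Fq] [Field Fqn] [Algebra Fq Fqn] {a : Fq} {δ : Fqn}

theorem X_pow_sub_one_div_X_sub_C {n : ℕ} (ha : a ^ n = 1) :
    ((X ^ n - 1) / (X - C a) : Fq[X]) = ∑ i ∈ Finset.range n, C (a ^ i) * X ^ (n - 1 - i) := by
  have key : (X ^ n - 1 : Fq[X]) =
      (X - C a) * ∑ i ∈ Finset.range n, C (a ^ i) * X ^ (n - 1 - i) := by
    have := (Commute.all (C a) (X : Fq[X])).mul_geom_sum₂ n
    simp only [← C_pow, ha, map_one] at this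
    linear_combination this
  rw [key, mul_div_cancel_left₀ _ (X_sub_C_ne_zero a)]

theorem X_pow_sub_one_div_X_sub_C_dvd {n : ℕ} (ha : a ^ n = 1) :
    ((X ^ n - 1) / (X - C a) : Fq[X]) ∣ X ^ n - 1 :=
  EuclideanDomain.div_dvd_of_dvd (dvd_iff_isRoot.2 (by simp [ha]))

/-- The twisted trace `x ↦ a⁻¹ · Tr(δ⁻¹ x)`. -/
noncomputable def twistedTrace (a : Fq) (δ : Fqn) : Fqn →ₗ[Fq] Fq :=
  a⁻¹ • (Algebra.trace Fq Fqn ∘ₗ LinearMap.mulLeft Fq δ⁻¹)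

theorem twistedTrace_apply (a : Fq) (δ x : Fqn) :
    twistedTrace a δ x = a⁻¹ * Algebra.trace Fq Fqn (δ⁻¹ * x) := by
  simp [twistedTrace]

theorem twistedTrace_eval (f : Fqn[X]) (hδ0 : δ ≠ 0) (c : Fq) :
    twistedTrace a δ (f.eval (δ * algebraMap Fq Fqn c)) =
      a⁻¹ * f.sum fun i ci => Algebra.trace Fq Fqn (δ ^ ((i : ℤ) - 1) * ci) * c ^ i := by
  rw [twistedTrace_apply, eval_eq_sum, Polynomial.sum, Polynomial.sum, Finset.mul_sum, map_sum]
  congr 1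
  refine Finset.sum_congr rfl fun i _ => ?_
  have : δ⁻¹ * (f.coeff i * (δ * algebraMap Fq Fqn c) ^ i) =
      c ^ i • (δ ^ ((i : ℤ) - 1) * f.coeff i) := by
    rw [zpow_sub_one₀ hδ0, zpow_natCast, Algebra.smul_def, map_pow]
    ring
  rw [this, map_smul, smul_eq_mul, mul_comm]

variable [Fintype Fq]

theorem frobenius_toLinearMap_pow_apply (i : ℕ) (x : Fqn) :
    ((frobeniusAlgHom Fq Fqn).toLinearMap ^ i) x = x ^ Fintype.card Fq ^ i := by
  rw [Module.End.coe_pow]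
  exact congr_fun (pow_iterate (Fintype.card Fq) i) x

theorem Lq_eq_aeval_frobenius_s19 (h : Fq[X]) (x : Fqn) :
    Lq h x = aeval (frobeniusAlgHom Fq Fqn).toLinearMap h x := by
  rw [Lq, aeval_eq_sum_range, Polynomial.sum_over_range _ (by simp)]
  simp [frobenius_toLinearMap_pow_apply, Algebra.smul_def]

theorem aeval_frobenius_X_pow_sub_one_div {n : ℕ} (ha : a ^ n = 1) (x : Fqn) :
    aeval (frobeniusAlgHom Fq Fqn).toLinearMap ((X ^ n - 1) / (X - C a)) x =
      ∑ i ∈ Finset.range n, algebraMap Fq Fqn (a ^ i) * x ^ Fintype.card Fq ^ (n - 1 - i) := by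
  rw [X_pow_sub_one_div_X_sub_C ha, map_sum, LinearMap.sum_apply]
  refine Finset.sum_congr rfl fun i _ => ?_
  rw [map_mul, aeval_C, aeval_X_pow, Module.End.mul_apply, Module.algebraMap_end_apply,
    frobenius_toLinearMap_pow_apply, Algebra.smul_def]

theorem pow_card_pow_of_eigen (hδ : δ ^ Fintype.card Fq = algebraMap Fq Fqn a * δ) (j : ℕ) :
    δ ^ Fintype.card Fq ^ j = algebraMap Fq Fqn (a ^ j) * δ := by
  induction j with
  | zero => simp
  | succ j ih =>
    rw [pow_succ, pow_mul, ih, mul_pow, hδ, ← map_pow, FiniteField.pow_card, pow_succ, map_mul,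
      mul_assoc]

theorem twistedTrace_surjective [FiniteDimensional Fq Fqn] (ha : a ≠ 0) (hδ0 : δ ≠ 0) :
    Function.Surjective (twistedTrace a δ) := by
  intro c
  obtain ⟨y, hy⟩ := Algebra.trace_surjective Fq Fqn (a * c)
  exact ⟨δ * y, by rw [twistedTrace_apply, inv_mul_cancel_left₀ hδ0, hy, inv_mul_cancel_left₀ ha]⟩

theorem sum_eq_mul_twistedTrace [FiniteDimensional Fq Fqn] {n : ℕ}
    (hrank : Module.finrank Fq Fqn = n) (ha : a ^ n = 1) (hδ0 : δ ≠ 0)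
    (hδ : δ ^ Fintype.card Fq = algebraMap Fq Fqn a * δ) (x : Fqn) :
    ∑ i ∈ Finset.range n, algebraMap Fq Fqn (a ^ i) * x ^ Fintype.card Fq ^ (n - 1 - i) =
      δ * algebraMap Fq Fqn (twistedTrace a δ x) := by
  have : Finite Fqn := Module.finite_of_finite Fq
  have hn : n ≠ 0 := hrank ▸ Module.finrank_pos.ne'
  have ha0 : a ≠ 0 := by
    rintro rfl
    simp [hn] at ha
  obtain ⟨y, rfl⟩ : ∃ y, x = δ * y := ⟨δ⁻¹ * x, (mul_inv_cancel_left₀ hδ0 x).symm⟩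
  have hinv : a⁻¹ = a ^ (n - 1) :=
    inv_eq_of_mul_eq_one_right (by rw [← pow_succ', Nat.sub_add_cancel (by omega), ha])
  rw [twistedTrace_apply, inv_mul_cancel_left₀ hδ0, map_mul, algebraMap_trace_eq_sum_pow, hrank,
    hinv, Nat.card_eq_fintype_card, ← Finset.sum_range_reflect, Finset.mul_sum, Finset.mul_sum]
  refine Finset.sum_congr rfl fun i hi => ?_
  have hi' : i ≤ n - 1 := by have := Finset.mem_range.1 hi; omega
  rw [Nat.sub_sub_self hi', mul_pow, pow_card_pow_of_eigen hδ, ← pow_sub_mul_pow a hi', map_mul]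
  ring

theorem aeval_frobenius_mul_algebraMap (hδ0 : δ ≠ 0)
    (hδ : δ ^ Fintype.card Fq = algebraMap Fq Fqn a * δ) (h : Fq[X]) (c : Fq) :
    aeval (frobeniusAlgHom Fq Fqn).toLinearMap h (δ * algebraMap Fq Fqn c) =
      δ * algebraMap Fq Fqn (h.eval a * c) := by
  have hvec : Module.End.HasEigenvector (frobeniusAlgHom Fq Fqn).toLinearMap a δ :=
    Module.End.hasEigenvector_iff.2
      ⟨Module.End.mem_eigenspace_iff.2 (by simpa [Algebra.smul_def] using hδ), hδ0⟩
  have hc : δ * algebraMap Fq Fqn c = c • δ := by rw [Algebra.smul_def, mul_comm]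
  rw [hc, map_smul, Module.End.aeval_apply_of_hasEigenvector hvec, Algebra.smul_def,
    Algebra.smul_def, map_mul]
  ring

end Frobenius

/-- **Permutation criterion for `g_a = (xⁿ-1)/(x-a)`.** Let `a ∈ 𝔽_q` with `aⁿ = 1` and
`δ ∈ 𝔽_{qⁿ}` nonzero with `δ^q = a·δ`. Let `L_{g_a}(x) = Σ_{i<n} aⁱ x^(q^(n-1-i))`, let
`h ∈ 𝔽_q[x]`, `f ∈ 𝔽_{qⁿ}[x]`, and `k ∈ 𝔽_{qⁿ}[x]` with `k(δ·c) ∈ 𝔽_q \ {0}` for every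
`c ∈ 𝔽_q` (witnessed by `κ : 𝔽_q → 𝔽_q`). Then `P(x) = f(L_{g_a}(x)) + k(L_{g_a}(x))·L_h(x)`
is a PP of `𝔽_{qⁿ}` iff `gcd(h, (xⁿ-1)/(x-a)) = 1` in `𝔽_q[x]` and
`Q̄_a(x) = a⁻¹·Σᵢ Tr(δ^(i-1)·aᵢ)·xⁱ + k(δx)·h(a)·x` is a PP of `𝔽_q`. -/
theorem PP_iff_ga_case {Fq Fqn : Type*} [Field Fq] [Fintype Fq] [DecidableEq Fq]
    [Field Fqn] [Algebra Fq Fqn]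
    {n : ℕ} (hn : 0 < n) (hrank : Module.finrank Fq Fqn = n)
    (a : Fq) (ha : a ^ n = 1)
    (δ : Fqn) (hδ0 : δ ≠ 0)
    (hδ : δ ^ Fintype.card Fq = algebraMap Fq Fqn a * δ)
    (h : Polynomial Fq) (f k : Polynomial Fqn)
    (κ : Fq → Fq)
    (hκ : ∀ c : Fq, κ c ≠ 0 ∧
      algebraMap Fq Fqn (κ c) = k.eval (δ * algebraMap Fq Fqn c)) :
    Function.Bijective (fun x : Fqn =>
        f.eval (∑ i ∈ Finset.range n,
            algebraMap Fq Fqn (a ^ i) * x ^ (Fintype.card Fq) ^ (n - 1 - i)) +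
          k.eval (∑ i ∈ Finset.range n,
            algebraMap Fq Fqn (a ^ i) * x ^ (Fintype.card Fq) ^ (n - 1 - i)) * Lq h x) ↔
      (gcd h ((X ^ n - 1) / (X - C a) : Polynomial Fq) = 1 ∧
        Function.Bijective fun x : Fq =>
          a⁻¹ * (f.sum fun i ci =>
              Algebra.trace Fq Fqn (δ ^ ((i : ℤ) - 1) * ci) * x ^ i) +
            κ x * h.eval a * x) := by
  have : FiniteDimensional Fq Fqn := Module.finite_of_finrank_pos (hrank ▸ hn)
  have : Finite Fqn := Module.finite_of_finite Fq
  have ha0 : a ≠ 0 := by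
    rintro rfl
    simp [hn.ne'] at ha
  set T := (FiniteField.frobeniusAlgHom Fq Fqn).toLinearMap
  have hG : ∀ x, aeval T ((X ^ n - 1) / (X - C a)) x =
      δ * algebraMap Fq Fqn (twistedTrace a δ x) := fun x => by
    rw [aeval_frobenius_X_pow_sub_one_div ha, sum_eq_mul_twistedTrace hrank ha hδ0 hδ]
  have hgcd : gcd h ((X ^ n - 1) / (X - C a) : Fq[X]) = 1 ↔
      ∀ x, aeval T h x = 0 → twistedTrace a δ x = 0 → x = 0 := by
    rw [← normalize_gcd, normalize_eq_one, gcd_isUnit_iff, isCoprime_iff_ker_aeval_disjoint T]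
    · simp [hG, hδ0]
    · rw [FiniteField.minpoly_frobeniusAlgHom, hrank]
      exact X_pow_sub_one_div_X_sub_C_dvd ha
  have htr : ∀ x, twistedTrace a δ (aeval T h x) = h.eval a * twistedTrace a δ x := fun x => by
    apply (algebraMap Fq Fqn).injective
    apply mul_left_cancel₀ hδ0
    rw [← hG, ← aeval_frobenius_mul_algebraMap hδ0 hδ, ← hG, ← Module.End.mul_apply,
      ← Module.End.mul_apply, ← map_mul, ← map_mul, mul_comm]
  simp only [sum_eq_mul_twistedTrace hrank ha hδ0 hδ, Lq_eq_aeval_frobenius_s19, ← (hκ _).2]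
  simp only [← Algebra.smul_def]
  rw [bijective_iff_of_semiconj (twistedTrace_surjective ha0 hδ0), hgcd]
  · refine and_congr_left fun _ => ⟨fun H x hx htx => H x 0 ?_ ?_, fun H x y hxy hR => ?_⟩
    · simpa using htx
    · simp [htx, T, hx]
    · rw [hxy] at hR
      have hL := smul_right_injective Fqn (hκ (twistedTrace a δ y)).1 (add_left_cancel hR)
      exact sub_eq_zero.1 (H _ (by rw [map_sub, sub_eq_zero]; exact hL)
        (by rw [map_sub, hxy, sub_self]))
  · intro x
    rw [map_add, map_smul, htr, twistedTrace_eval f hδ0, smul_eq_mul, mul_assoc]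
end
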